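/- Let 𝒜 be a finite type, N a natural number, and let X = (x_1, …, x_N) be a random vector with values in 𝒜^N given by a probability mass function p. Let τ ∈ [0,1], let M = (M_1, …, M_N) be a Boolean random vector independent of X with independent coordinates satisfying P(M_j = revealed) = 1 − τ for each j, and fix a position i. Define the masked sequence X̃ over the alphabet 𝒜 ⊕ {MASK} by X̃_j = x_j if M_j = revealed and X̃_j = MASK otherwise. Then the conditional mutual information of the masked variables decomposes as the mask-average of fixed-pattern conditional mutual informations: I(x_i ; X̃_{>i} ∣ X̃_{<i}) = Σ_m P(M = m) · I(x_i ; X_{R_{>i}(m)} ∣ X_{R_{<i}(m)}), where for a mask pattern m, R_{<i}(m) = {j < i : m_j = revealed} and R_{>i}(m) = {j > i : m_j = revealed}, and X_S denotes the restriction of X to the coordinates in S. -/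

import Mathlib

/-- Joint probability mass function of the random variable `X` under the pmf `p`. -/
noncomputable def jointPMF {Ω α : Type*} [Fintype Ω] [DecidableEq α]
    (p : Ω → ℝ) (X : Ω → α) (a : α) : ℝ :=
  ∑ ω, if X ω = a then p ω else 0

/-- Conditional mutual information `I(X ; Y ∣ Z)` for finitely supported random variables:
`I(X;Y∣Z) = Σ_{x,y,z} p(x,y,z) · log( p(x,y,z)·p(z) / (p(x,z)·p(y,z)) )`,
with the conventions `0 · log 0 = 0` and division by zero yielding `0`. -/
noncomputable def condMutualInfo {Ω α β γ : Type*} [Fintype Ω]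
    [Fintype α] [Fintype β] [Fintype γ] [DecidableEq α] [DecidableEq β] [DecidableEq γ]
    (p : Ω → ℝ) (X : Ω → α) (Y : Ω → β) (Z : Ω → γ) : ℝ :=
  ∑ x : α, ∑ y : β, ∑ z : γ,
    jointPMF p (fun ω => (X ω, Y ω, Z ω)) (x, y, z) *
      Real.log ((jointPMF p (fun ω => (X ω, Y ω, Z ω)) (x, y, z) * jointPMF p Z z) /
        (jointPMF p (fun ω => (X ω, Z ω)) (x, z) * jointPMF p (fun ω => (Y ω, Z ω)) (y, z)))


/-- Restriction of a vector `x : Fin N → 𝒜` to the coordinates satisfying `P`. -/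
def restr {𝒜 : Type*} {N : ℕ} (P : Fin N → Prop) (x : Fin N → 𝒜) :
    {j : Fin N // P j} → 𝒜 :=
  fun j => x j.1

/-- The masked sequence restricted to the coordinates satisfying `P`:
`X̃_j = x_j` if `m_j = revealed` (`true`) and `X̃_j = MASK` (`none`) otherwise, over the
extended alphabet `𝒜 ⊕ {MASK}` realized as `Option 𝒜`. -/
def maskedRestr {𝒜 : Type*} {N : ℕ} (P : Fin N → Prop)
    (xm : (Fin N → 𝒜) × (Fin N → Bool)) : {j : Fin N // P j} → Option 𝒜 :=
  fun j => if xm.2 j.1 then some (xm.1 j.1) else none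

theorem condMutualInfo_eq_expect {Ω α β γ : Type*} [Fintype Ω]
    [Fintype α] [Fintype β] [Fintype γ] [DecidableEq α] [DecidableEq β] [DecidableEq γ]
    (p : Ω → ℝ) (X : Ω → α) (Y : Ω → β) (Z : Ω → γ) :
    condMutualInfo p X Y Z = ∑ ω, p ω *
      Real.log ((jointPMF p (fun ω => (X ω, Y ω, Z ω)) (X ω, Y ω, Z ω) * jointPMF p Z (Z ω)) /
        (jointPMF p (fun ω => (X ω, Z ω)) (X ω, Z ω) *
          jointPMF p (fun ω => (Y ω, Z ω)) (Y ω, Z ω))) := by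
  have key : ∀ f : α × β × γ → ℝ,
      ∑ x, ∑ y, ∑ z, jointPMF p (fun ω => (X ω, Y ω, Z ω)) (x, y, z) * f (x, y, z)
        = ∑ ω, p ω * f (X ω, Y ω, Z ω) := by
    intro f
    have h : ∑ x, ∑ y, ∑ z, jointPMF p (fun ω => (X ω, Y ω, Z ω)) (x, y, z) * f (x, y, z)
        = ∑ a : α × β × γ, jointPMF p (fun ω => (X ω, Y ω, Z ω)) a * f a := by
      simp only [Fintype.sum_prod_type]
    rw [h]
    simp only [jointPMF, Finset.sum_mul]
    rw [Finset.sum_comm]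
    refine Finset.sum_congr rfl fun ω _ => ?_
    simp only [ite_mul, zero_mul, Finset.sum_ite_eq, Finset.mem_univ, if_true]
  exact key (fun a => Real.log ((jointPMF p (fun ω => (X ω, Y ω, Z ω)) a * jointPMF p Z a.2.2) /
        (jointPMF p (fun ω => (X ω, Z ω)) (a.1, a.2.2) *
          jointPMF p (fun ω => (Y ω, Z ω)) (a.2.1, a.2.2))))

theorem jointPMF_product {Ω M α β : Type*} [Fintype Ω] [Fintype M] [DecidableEq α]
    [DecidableEq β] (p : Ω → ℝ) (w : M → ℝ) (F : Ω × M → α) (G : Ω → β) (B : M → Prop)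
    [DecidablePred B] (a : α) (b : β) (h : ∀ x m, F (x, m) = a ↔ (B m ∧ G x = b)) :
    jointPMF (fun xm : Ω × M => p xm.1 * w xm.2) F a
      = (∑ m, if B m then w m else 0) * jointPMF p G b := by
  simp only [jointPMF, Fintype.sum_prod_type, h]
  rw [Finset.sum_mul_sum, Finset.sum_comm]
  refine Finset.sum_congr rfl fun m _ => Finset.sum_congr rfl fun x _ => ?_
  by_cases h1 : B m <;> by_cases h2 : G x = b <;> simp [h1, h2, mul_comm]

theorem maskedRestr_eq_iff {𝒜 : Type*} {N : ℕ} (P : Fin N → Prop) (x x' : Fin N → 𝒜)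
    (m m' : Fin N → Bool) :
    maskedRestr P (x', m') = maskedRestr P (x, m) ↔
      ((∀ j, P j → m' j = m j) ∧
        restr (fun j => P j ∧ m j = true) x' = restr (fun j => P j ∧ m j = true) x) := by
  simp only [funext_iff, maskedRestr, restr, Subtype.forall]
  constructor
  · intro h
    refine ⟨fun j hj => ?_, fun j hj => ?_⟩
    · have := h j hj
      cases h1 : m j <;> cases h2 : m' j <;> simp_all
    · have := h j hj.1
      cases h2 : m' j <;> simp_all
  · rintro ⟨h1, h2⟩ j hj
    rw [h1 j hj]
    cases h3 : m j
    · simp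
    · simp [h2 j ⟨hj, h3⟩]

/-- **Mask-average decomposition of the masked conditional mutual information.**
Let `X = (x_1, …, x_N)` have pmf `p` on `Fin N → 𝒜` and let `M = (M_1, …, M_N)` be an
independent Boolean mask with independent coordinates revealed (`M_j = true`) with
probability `1 − τ`; the joint pmf of `(X, M)` is `q(x, m) = p(x) · ∏_j (if m_j then 1 − τ else τ)`.
With `X̃_j = x_j` if `M_j` revealed and `MASK` otherwise, the conditional mutual information of
the masked variables decomposes as the mask-average of fixed-pattern conditional mutual
informations:
`I(x_i ; X̃_{>i} ∣ X̃_{<i}) = Σ_m P(M = m) · I(x_i ; X_{R_{>i}(m)} ∣ X_{R_{<i}(m)})`,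
where `R_{<i}(m) = {j < i : m_j revealed}` and `R_{>i}(m) = {j > i : m_j revealed}`. -/
theorem condMutualInfo_masked_decomposition
    {𝒜 : Type*} [Fintype 𝒜] [DecidableEq 𝒜] {N : ℕ}
    (p : (Fin N → 𝒜) → ℝ) (hp : ∀ x, 0 ≤ p x) (hp1 : ∑ x, p x = 1)
    (τ : ℝ) (hτ : τ ∈ Set.Icc (0 : ℝ) 1) (i : Fin N) :
    condMutualInfo
        (fun xm : (Fin N → 𝒜) × (Fin N → Bool) =>
          p xm.1 * ∏ j : Fin N, if xm.2 j then 1 - τ else τ)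
        (fun xm => xm.1 i)
        (maskedRestr (fun j => i < j))
        (maskedRestr (fun j => j < i))
      = ∑ m : Fin N → Bool,
          (∏ j : Fin N, if m j then 1 - τ else τ) *
            condMutualInfo p (fun x => x i)
              (restr (fun j => i < j ∧ m j = true))
              (restr (fun j => j < i ∧ m j = true)) := by
  classical
  rw [condMutualInfo_eq_expect, Fintype.sum_prod_type, Finset.sum_comm]
  refine Finset.sum_congr rfl fun m _ => ?_
  rw [condMutualInfo_eq_expect, Finset.mul_sum]
  refine Finset.sum_congr rfl fun x _ => ?_
  set w : (Fin N → Bool) → ℝ := fun m => ∏ j : Fin N, if m j then 1 - τ else τ with hw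
  have hw0 : ∀ m, 0 ≤ w m := fun m => Finset.prod_nonneg fun j _ => by
    split_ifs <;> linarith [hτ.1, hτ.2]
  have hW : ∀ (B : (Fin N → Bool) → Prop) [DecidablePred B], B m → w m ≠ 0 →
      (∑ m', if B m' then w m' else 0) ≠ 0 := by
    intro B _ hB hm
    have h1 : w m ≤ ∑ m', if B m' then w m' else 0 := by
      have := Finset.single_le_sum (f := fun m' => if B m' then w m' else 0)
        (fun m' _ => by split_ifs; exacts [hw0 _, le_rfl]) (Finset.mem_univ m)
      simpa [hB] using this
    exact ((lt_of_le_of_ne (hw0 m) hm.symm).trans_le h1).ne'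
  change p x * w m * _ = w m * (p x * _)
  by_cases hm : w m = 0
  · simp [hm]
  rw [mul_comm (p x), mul_assoc]
  congr 3
  let B1 : (Fin N → Bool) → Prop := fun m' => ∀ j, j < i → m' j = m j
  let B2 : (Fin N → Bool) → Prop := fun m' => ∀ j, i < j → m' j = m j
  have e1 := jointPMF_product p w
    (fun xm : (Fin N → 𝒜) × (Fin N → Bool) =>
      (xm.1 i, maskedRestr (fun j => i < j) xm, maskedRestr (fun j => j < i) xm))
    (fun x => (x i, restr (fun j => i < j ∧ m j = true) x, restr (fun j => j < i ∧ m j = true) x))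
    (fun m' => B2 m' ∧ B1 m')
    (x i, maskedRestr (fun j => i < j) (x, m), maskedRestr (fun j => j < i) (x, m))
    (x i, restr (fun j => i < j ∧ m j = true) x, restr (fun j => j < i ∧ m j = true) x)
    (fun x' m' => by simp only [Prod.mk.injEq, maskedRestr_eq_iff, B1, B2]; tauto)
  have e2 := jointPMF_product p w
    (maskedRestr (fun j => j < i)) (restr (fun j => j < i ∧ m j = true)) B1
    (maskedRestr (fun j => j < i) (x, m)) (restr (fun j => j < i ∧ m j = true) x)
    (fun x' m' => by simp only [maskedRestr_eq_iff, B1])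
  have e3 := jointPMF_product p w
    (fun xm : (Fin N → 𝒜) × (Fin N → Bool) => (xm.1 i, maskedRestr (fun j => j < i) xm))
    (fun x => (x i, restr (fun j => j < i ∧ m j = true) x)) B1
    (x i, maskedRestr (fun j => j < i) (x, m)) (x i, restr (fun j => j < i ∧ m j = true) x)
    (fun x' m' => by simp only [Prod.mk.injEq, maskedRestr_eq_iff, B1]; tauto)
  have e4 := jointPMF_product p w
    (fun xm : (Fin N → 𝒜) × (Fin N → Bool) =>
      (maskedRestr (fun j => i < j) xm, maskedRestr (fun j => j < i) xm))
    (fun x => (restr (fun j => i < j ∧ m j = true) x, restr (fun j => j < i ∧ m j = true) x))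
    (fun m' => B2 m' ∧ B1 m')
    (maskedRestr (fun j => i < j) (x, m), maskedRestr (fun j => j < i) (x, m))
    (restr (fun j => i < j ∧ m j = true) x, restr (fun j => j < i ∧ m j = true) x)
    (fun x' m' => by simp only [Prod.mk.injEq, maskedRestr_eq_iff, B1, B2]; tauto)
  have hB1 : B1 m := fun _ _ => rfl
  have hB2 : B2 m := fun _ _ => rfl
  have n1 := hW _ hB1 hm
  have n2 := hW (fun m' => B2 m' ∧ B1 m') ⟨hB2, hB1⟩ hm
  refine (congrArg₂ (· / ·) (congrArg₂ (· * ·) e1 e2) (congrArg₂ (· * ·) e3 e4)).trans ?_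
  rw [mul_mul_mul_comm, mul_mul_mul_comm (∑ m', if B1 m' then w m' else 0),
    mul_comm (∑ m', if B1 m' then w m' else 0)]
  exact mul_div_mul_left _ _ (mul_ne_zero n2 n1)
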